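/- arXiv:2206.09342 — 2 statements merged into one kernel-verified Lean document; each statement's English description precedes it below -/
import Mathlib

section
/- Fix ε > 0, κ > 0, r > 0, m ≥ 2, μ > 0 and U3 ∈ ℝ. On {x ∈ ℝ³ : 0 < |x'| < r} define δ(x') = ε + 2κ|x'|^m, G(x) = x3/δ(x'), x'·∇'δ = 2κm|x'|^m, K(x') = 3(x'·∇'δ)/δ − 2, the velocity ū⁽³⁾(x) = U3[(1/2 + G)e₃ + (G² − 1/4)((3x1/δ)e₁ + (3x2/δ)e₂ + G·K e₃)], and the pressure p̄⁽³⁾(x) = μ U3[(3x3²/δ³)K(x') + 3∫_{r²}^{|x'|²}(ε + 2κ t^{m/2})^{−3} dt]. Then at every such point: μ ∂₃₃ū⁽³⁾ᵢ(x) − ∂ᵢ p̄⁽³⁾(x) = −3μ U3 x3² ∂ᵢ[δ^{−3}K](x') for i = 1, 2, and μ ∂₃₃ū⁽³⁾₃(x) − ∂₃ p̄⁽³⁾(x) = 0. -/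
/-- Gap width `δ(x') = ε + 2κ|x'|^m`. -/
noncomputable def δf (ε κ m x1 x2 : ℝ) : ℝ := ε + 2 * κ * Real.sqrt (x1 ^ 2 + x2 ^ 2) ^ m

/-- `K(x') = 3(x'·∇'δ)/δ − 2` with `x'·∇'δ = 2κm|x'|^m`. -/
noncomputable def Kf (ε κ m x1 x2 : ℝ) : ℝ :=
  3 * (2 * κ * m * Real.sqrt (x1 ^ 2 + x2 ^ 2) ^ m) / δf ε κ m x1 x2 - 2

/-- The squeeze-motion pressure
`p̄⁽³⁾ = μU3[(3x₃²/δ³)K + 3∫_{r²}^{|x'|²}(ε+2κt^{m/2})^{−3}dt]`. -/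
noncomputable def p3 (ε κ r m μ U3 x1 x2 x3 : ℝ) : ℝ :=
  μ * U3 * (3 * x3 ^ 2 / (δf ε κ m x1 x2) ^ 3 * Kf ε κ m x1 x2
    + 3 * ∫ t in (r ^ 2)..(x1 ^ 2 + x2 ^ 2), (ε + 2 * κ * t ^ (m / 2)) ^ (-(3 : ℝ)))

theorem δf_comm (ε κ m x y : ℝ) : δf ε κ m x y = δf ε κ m y x := by
  simp only [δf, add_comm]

theorem Kf_comm (ε κ m x y : ℝ) : Kf ε κ m x y = Kf ε κ m y x := by
  simp only [Kf, δf, add_comm]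

theorem p3_comm (ε κ r m μ U3 x y z : ℝ) :
    p3 ε κ r m μ U3 x y z = p3 ε κ r m μ U3 y x z := by
  simp only [p3, Kf, δf, add_comm]

theorem δf_pos {ε κ : ℝ} (hε : 0 < ε) (hκ : 0 < κ) (m x y : ℝ) : 0 < δf ε κ m x y := by
  unfold δf
  positivity

theorem δf_eq_rpow_half (ε κ m x y : ℝ) :
    ε + 2 * κ * (x ^ 2 + y ^ 2) ^ (m / 2) = δf ε κ m x y := by
  rw [δf, Real.sqrt_eq_rpow, ← Real.rpow_mul (by positivity)]
  ring_nf

theorem sq_add_sq_pos_of_ne_zero {x y : ℝ} (h : (x, y) ≠ (0, 0)) : 0 < x ^ 2 + y ^ 2 := by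
  by_contra! hle
  have hx : x = 0 := by nlinarith [sq_nonneg x, sq_nonneg y]
  have hy : y = 0 := by nlinarith [sq_nonneg x, sq_nonneg y]
  exact h (by rw [hx, hy])

theorem differentiableAt_sqrt_rpow {x y : ℝ} (m : ℝ) (h : 0 < x ^ 2 + y ^ 2) :
    DifferentiableAt ℝ (fun t => Real.sqrt (t ^ 2 + y ^ 2) ^ m) x :=
  DifferentiableAt.rpow_const
    (DifferentiableAt.sqrt (f := fun t : ℝ => t ^ 2 + y ^ 2) (by fun_prop) h.ne')
    (Or.inl (Real.sqrt_pos.2 h).ne')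

theorem differentiableAt_δf {x y : ℝ} (ε κ m : ℝ) (h : 0 < x ^ 2 + y ^ 2) :
    DifferentiableAt ℝ (fun t => δf ε κ m t y) x :=
  ((differentiableAt_sqrt_rpow m h).const_mul _).const_add _

theorem differentiableAt_Kf_div_δf_cube {ε κ x y : ℝ} (hε : 0 < ε) (hκ : 0 < κ) (m : ℝ)
    (h : 0 < x ^ 2 + y ^ 2) :
    DifferentiableAt ℝ (fun t => Kf ε κ m t y / (δf ε κ m t y) ^ 3) x := by
  have hδ := differentiableAt_δf ε κ m h
  have hδ0 := (δf_pos hε hκ m x y).ne'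
  refine DifferentiableAt.div ?_ (hδ.pow 3) (pow_ne_zero 3 hδ0)
  exact ((((differentiableAt_sqrt_rpow m h).const_mul _).const_mul _).div hδ hδ0).sub_const _

theorem hasDerivAt_integral_gap {ε κ m a b : ℝ} (hε : 0 < ε) (hκ : 0 < κ)
    (ha : 0 < a) (hb : 0 < b) :
    HasDerivAt (fun u => ∫ t in a..u, (ε + 2 * κ * t ^ (m / 2)) ^ (-(3 : ℝ)))
      ((ε + 2 * κ * b ^ (m / 2)) ^ (-(3 : ℝ))) b := by
  have hcont : ∀ t : ℝ, 0 < t →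
      ContinuousAt (fun t : ℝ => (ε + 2 * κ * t ^ (m / 2)) ^ (-(3 : ℝ))) t := fun t ht =>
    ContinuousAt.rpow_const
      (((Real.continuousAt_rpow_const t _ (Or.inl ht.ne')).const_mul _).const_add _)
      (Or.inl (by positivity))
  have hmeas : Measurable fun t : ℝ => (ε + 2 * κ * t ^ (m / 2)) ^ (-(3 : ℝ)) := by fun_prop
  refine intervalIntegral.integral_hasDerivAt_right ?_
    hmeas.stronglyMeasurable.stronglyMeasurableAtFilter (hcont b hb)
  exact ContinuousOn.intervalIntegrable fun t ht =>
    (hcont t ((lt_min ha hb).trans_le ht.1)).continuousWithinAt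

theorem deriv_p3_fst {ε κ r x y : ℝ} (m μ U3 z : ℝ) (hε : 0 < ε) (hκ : 0 < κ) (hr : 0 < r)
    (h : 0 < x ^ 2 + y ^ 2) :
    deriv (fun t => p3 ε κ r m μ U3 t y z) x
      = μ * U3 * (3 * z ^ 2 * deriv (fun t => Kf ε κ m t y / (δf ε κ m t y) ^ 3) x
        + 6 * x / (δf ε κ m x y) ^ 3) := by
  have hsq : HasDerivAt (fun t : ℝ => t ^ 2 + y ^ 2) (2 * x) x := by
    simpa using (hasDerivAt_pow 2 x).add_const (y ^ 2)
  have hint := (hasDerivAt_integral_gap (m := m) hε hκ (pow_pos hr 2) h).comp x hsq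
  have hK := (differentiableAt_Kf_div_δf_cube hε hκ m h).hasDerivAt
  have hp := ((hK.const_mul (3 * z ^ 2)).add (hint.const_mul 3)).const_mul (μ * U3)
  have hδ := δf_pos hε hκ m x y
  rw [δf_eq_rpow_half, Real.rpow_neg hδ.le,
    show (δf ε κ m x y) ^ (3 : ℝ) = (δf ε κ m x y) ^ 3 by exact_mod_cast Real.rpow_natCast _ 3] at hp
  refine Eq.trans ?_ (hp.deriv.trans ?_)
  · congr 1
    funext t
    simp only [p3, Pi.add_apply, Function.comp_apply]
    ring
  · ring

theorem deriv_deriv_cubic (a b c d x : ℝ) :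
    deriv (fun t => deriv (fun s : ℝ => a * s ^ 3 + b * s ^ 2 + c * s + d) t) x
      = 6 * a * x + 2 * b := by
  have h1 : ∀ t : ℝ, deriv (fun s : ℝ => a * s ^ 3 + b * s ^ 2 + c * s + d) t
      = 3 * a * t ^ 2 + 2 * b * t + c := fun t => by
    have := ((((hasDerivAt_pow 3 t).const_mul a).add ((hasDerivAt_pow 2 t).const_mul b)).add
      ((hasDerivAt_id t).const_mul c)).add_const d
    refine Eq.trans this.deriv ?_
    norm_num
    ring
  simp only [h1]
  have := (((hasDerivAt_pow 2 x).const_mul (3 * a)).add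
    ((hasDerivAt_id x).const_mul (2 * b))).add_const c
  refine Eq.trans this.deriv ?_
  norm_num
  ring

theorem deriv_deriv_horizontal_velocity (U d x z : ℝ) :
    deriv (fun t => deriv (fun s => U * (((s / d) ^ 2 - 1 / 4) * (3 * x / d))) t) z
      = 6 * U * x / d ^ 3 := by
  have h : (fun s => U * (((s / d) ^ 2 - 1 / 4) * (3 * x / d)))
      = fun s => 0 * s ^ 3 + (3 * U * x / d ^ 3) * s ^ 2 + 0 * s + -(3 * U * x / (4 * d)) := by
    funext s
    ring
  rw [h, deriv_deriv_cubic]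
  ring

theorem deriv_deriv_vertical_velocity (U d k z : ℝ) :
    deriv (fun t => deriv
      (fun s => U * ((1 / 2 + s / d) + ((s / d) ^ 2 - 1 / 4) * (s / d) * k)) t) z
      = 6 * U * k * z / d ^ 3 := by
  have h : (fun s => U * ((1 / 2 + s / d) + ((s / d) ^ 2 - 1 / 4) * (s / d) * k))
      = fun s => (U * k / d ^ 3) * s ^ 3 + 0 * s ^ 2 + (U * (1 - k / 4) / d) * s + U / 2 := by
    funext s
    ring
  rw [h, deriv_deriv_cubic]
  ring

theorem deriv_p3_vertical (ε κ r m μ U3 x y z : ℝ) :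
    deriv (fun t => p3 ε κ r m μ U3 x y t) z
      = 6 * μ * U3 * Kf ε κ m x y * z / (δf ε κ m x y) ^ 3 := by
  unfold p3
  have := ((((((hasDerivAt_pow 2 z).const_mul 3).div_const ((δf ε κ m x y) ^ 3)).mul_const
    (Kf ε κ m x y)).add_const (3 * ∫ t in (r ^ 2)..(x ^ 2 + y ^ 2),
      (ε + 2 * κ * t ^ (m / 2)) ^ (-(3 : ℝ)))).const_mul (μ * U3))
  refine Eq.trans this.deriv ?_
  norm_num
  ring

/-- For the explicit squeeze-motion pair
`ū⁽³⁾ = U3[(1/2+G)e₃ + (G²−1/4)((3x₁/δ)e₁ + (3x₂/δ)e₂ + G·K e₃)]` and `p̄⁽³⁾`,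
one has on `0 < |x'| < r`:
`μ∂₃₃ū⁽³⁾ᵢ − ∂ᵢp̄⁽³⁾ = −3μU3x₃²∂ᵢ[δ^{−3}K]` for `i = 1,2`, and
`μ∂₃₃ū⁽³⁾₃ − ∂₃p̄⁽³⁾ = 0`. -/
theorem stmt9 (ε κ r m μ U3 : ℝ) (hε : 0 < ε) (hκ : 0 < κ) (hr : 0 < r)
    (hm : 2 ≤ m) (hμ : 0 < μ) :
    ∀ x1 x2 x3 : ℝ, (x1, x2) ≠ (0, 0) → Real.sqrt (x1 ^ 2 + x2 ^ 2) < r →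
      (μ * deriv (fun t => deriv
            (fun s => U3 * (((s / δf ε κ m x1 x2) ^ 2 - 1 / 4)
              * (3 * x1 / δf ε κ m x1 x2))) t) x3
          - deriv (fun t => p3 ε κ r m μ U3 t x2 x3) x1
        = -(3 * μ * U3 * x3 ^ 2)
            * deriv (fun t => Kf ε κ m t x2 / (δf ε κ m t x2) ^ 3) x1) ∧
      (μ * deriv (fun t => deriv
            (fun s => U3 * (((s / δf ε κ m x1 x2) ^ 2 - 1 / 4)
              * (3 * x2 / δf ε κ m x1 x2))) t) x3
          - deriv (fun t => p3 ε κ r m μ U3 x1 t x3) x2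
        = -(3 * μ * U3 * x3 ^ 2)
            * deriv (fun t => Kf ε κ m x1 t / (δf ε κ m x1 t) ^ 3) x2) ∧
      (μ * deriv (fun t => deriv
            (fun s => U3 * ((1 / 2 + s / δf ε κ m x1 x2)
              + ((s / δf ε κ m x1 x2) ^ 2 - 1 / 4) * (s / δf ε κ m x1 x2)
                  * Kf ε κ m x1 x2)) t) x3
          - deriv (fun t => p3 ε κ r m μ U3 x1 x2 t) x3 = 0) := by
  intro x1 x2 x3 hne _
  have h12 := sq_add_sq_pos_of_ne_zero hne
  have h21 : 0 < x2 ^ 2 + x1 ^ 2 := by rwa [add_comm]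
  refine ⟨?_, ?_, ?_⟩
  · rw [deriv_deriv_horizontal_velocity, deriv_p3_fst m μ U3 x3 hε hκ hr h12]
    ring
  · simp only [p3_comm ε κ r m μ U3 x1, Kf_comm ε κ m x1, δf_comm ε κ m x1]
    rw [deriv_deriv_horizontal_velocity, deriv_p3_fst m μ U3 x3 hε hκ hr h21]
    ring
  · rw [deriv_deriv_vertical_velocity, deriv_p3_vertical]
    ring
end

section
/- Fix κ > 0, 0 < r, R > 0, m ≥ 2, μ > 0 and c ∈ ℝ. For ε ∈ (0,1) let δ(x') = ε + 2κ|x'|^m, h(x') = κ|x'|^m, G(x) = x3/δ(x'), ū⁽¹⁾(x) = c(1/2+G)e₁ + c(G²−1/4)(∂₁δ/2)e₃, p̄⁽¹⁾(x) = μ c x3∂₁δ/δ², and σ[ū⁽¹⁾,p̄⁽¹⁾] = 2μ e(ū⁽¹⁾) − p̄⁽¹⁾·Id₃. Then there exists C > 0, independent of ε, such that for all ε ∈ (0,1): ‖ ∫_{|x'|<r} (x1, x2, h(x') − R) × [σ[ū⁽¹⁾,p̄⁽¹⁾](x', δ(x')/2)·(∂₁h, ∂₂h, −1)] dx' − 2πμ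 R c Γ₁₂⁽ᵐ⁾ ρ₁₂⁽ᵐ⁾(ε) e₂ ‖ ≤ C, where × is the cross product and the norm is the Euclidean norm of ℝ³. -/
open Matrix MeasureTheory

/-- `∂₁δ(x') = 2κm|x'|^{m−2}x₁`. -/
noncomputable def d1δ (κ m x1 x2 : ℝ) : ℝ :=
  2 * κ * m * Real.sqrt (x1 ^ 2 + x2 ^ 2) ^ (m - 2) * x1

/-- The approximate shear velocity `ū⁽¹⁾ = c(1/2+G)e₁ + c(G²−1/4)(∂₁δ/2)e₃`. -/
noncomputable def ubar1 (ε κ m c : ℝ) (x1 x2 x3 : ℝ) : Fin 3 → ℝ :=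
  ![c * (1 / 2 + x3 / δf ε κ m x1 x2), 0,
    c * ((x3 / δf ε κ m x1 x2) ^ 2 - 1 / 4) * (d1δ κ m x1 x2 / 2)]

/-- The approximate shear pressure `p̄⁽¹⁾ = μcx₃∂₁δ/δ²`. -/
noncomputable def pbar1 (ε κ m μ c x1 x2 x3 : ℝ) : ℝ :=
  μ * c * x3 * d1δ κ m x1 x2 / (δf ε κ m x1 x2) ^ 2

/-- Jacobian matrix `(∇v)_{kl} = ∂ₗvₖ`. -/
noncomputable def grad3 (v : ℝ → ℝ → ℝ → Fin 3 → ℝ) (x1 x2 x3 : ℝ) :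
    Matrix (Fin 3) (Fin 3) ℝ :=
  Matrix.of fun k l =>
    ![deriv (fun t => v t x2 x3 k) x1, deriv (fun t => v x1 t x3 k) x2,
      deriv (fun t => v x1 x2 t k) x3] l

/-- Rate of strain tensor `e(v) = (∇v + (∇v)ᵀ)/2`. -/
noncomputable def symGrad (v : ℝ → ℝ → ℝ → Fin 3 → ℝ) (x1 x2 x3 : ℝ) :
    Matrix (Fin 3) (Fin 3) ℝ :=
  (1 / 2 : ℝ) • (grad3 v x1 x2 x3 + (grad3 v x1 x2 x3)ᵀ)

/-- Cauchy stress `σ[ū⁽¹⁾,p̄⁽¹⁾] = 2μe(ū⁽¹⁾) − p̄⁽¹⁾·Id`. -/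
noncomputable def sigma1 (ε κ m μ c x1 x2 x3 : ℝ) : Matrix (Fin 3) (Fin 3) ℝ :=
  (2 * μ) • symGrad (ubar1 ε κ m c) x1 x2 x3
    - pbar1 ε κ m μ c x1 x2 x3 • (1 : Matrix (Fin 3) (Fin 3) ℝ)

/-- `Γ₁₂⁽ᵐ⁾`. -/
noncomputable def Γ12 (κ m : ℝ) : ℝ :=
  if m = 2 then 1 / (4 * κ)
  else Real.Gamma (1 - 2 / m) * Real.Gamma (2 / m) / (m * (2 * κ) ^ (2 / m))

/-- `ρ₁₂⁽ᵐ⁾(ε)`. -/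
noncomputable def ρ12 (m ε : ℝ) : ℝ := if m = 2 then |Real.log ε| else ε ^ (2 / m - 1)

/-- Euclidean norm on `ℝ³`. -/
noncomputable def enorm3 (v : Fin 3 → ℝ) : ℝ :=
  Real.sqrt ((v 0) ^ 2 + (v 1) ^ 2 + (v 2) ^ 2)

/-- The torque density of the shear flow on the upper gap boundary, with the stress evaluated. -/
noncomputable def gapTorque (ε κ R m μ c x1 x2 : ℝ) : Fin 3 → ℝ :=
  let δ := δf ε κ m x1 x2
  let D := d1δ κ m x1 x2
  let E := d1δ κ m x2 x1
  let a := κ * Real.sqrt (x1 ^ 2 + x2 ^ 2) ^ m - R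
  let f1 := -(μ * c / δ) * (1 + D ^ 2 / 2 + E ^ 2 / 4)
  let f2 := -(μ * c / δ) * (D * E / 4)
  let f3 := -(μ * c / δ) * (D * (D ^ 2 + E ^ 2) / 8)
  ![x2 * f3 - a * f2, a * f1 - x1 * f3, x1 * f2 - x2 * f1]

lemma δf_swap (ε κ m x1 x2 : ℝ) : δf ε κ m x1 x2 = δf ε κ m x2 x1 := by
  simp only [δf, add_comm]

lemma le_δf {ε κ m x1 x2 : ℝ} (hκ : 0 < κ) : ε ≤ δf ε κ m x1 x2 := by
  unfold δf
  have : 0 ≤ Real.sqrt (x1 ^ 2 + x2 ^ 2) ^ m := by positivity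
  nlinarith

lemma hasDerivAt_sqrt_sq_add_sq_rpow (m x1 x2 : ℝ) (h : 0 < x1 ^ 2 + x2 ^ 2) :
    HasDerivAt (fun t => Real.sqrt (t ^ 2 + x2 ^ 2) ^ m)
      (m * Real.sqrt (x1 ^ 2 + x2 ^ 2) ^ (m - 2) * x1) x1 := by
  have hs : 0 < Real.sqrt (x1 ^ 2 + x2 ^ 2) := Real.sqrt_pos.2 h
  have h1 : HasDerivAt (fun t : ℝ => t ^ 2 + x2 ^ 2) (2 * x1) x1 := by
    simpa using (hasDerivAt_pow 2 x1).add_const (x2 ^ 2)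
  convert! (h1.sqrt h.ne').rpow_const (p := m) (Or.inl hs.ne') using 1
  rw [show m - 1 = (m - 2) + 1 by ring, Real.rpow_add_one hs.ne']
  field_simp

lemma hasDerivAt_δf (ε κ m x1 x2 : ℝ) (h : 0 < x1 ^ 2 + x2 ^ 2) :
    HasDerivAt (fun t => δf ε κ m t x2) (d1δ κ m x1 x2) x1 := by
  convert! ((hasDerivAt_sqrt_sq_add_sq_rpow m x1 x2 h).const_mul (2 * κ)).const_add ε using 1
  simp only [d1δ]; ring

lemma differentiableAt_d1δ_left (κ m x1 x2 : ℝ) (h : 0 < x1 ^ 2 + x2 ^ 2) :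
    DifferentiableAt ℝ (fun t => d1δ κ m t x2) x1 :=
  ((hasDerivAt_sqrt_sq_add_sq_rpow (m - 2) x1 x2 h).differentiableAt.const_mul _).mul
    differentiableAt_id

lemma differentiableAt_d1δ_right (κ m x1 x2 : ℝ) (h : 0 < x1 ^ 2 + x2 ^ 2) :
    DifferentiableAt ℝ (fun t => d1δ κ m x1 t) x2 := by
  have := (hasDerivAt_sqrt_sq_add_sq_rpow (m - 2) x2 x1 (by linarith)).differentiableAt
  simp only [d1δ, add_comm (x1 ^ 2)]
  fun_prop

lemma hasDerivAt_gapRatio {f : ℝ → ℝ} {f' x : ℝ} (hf : HasDerivAt f f' x) (h0 : f x ≠ 0) :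
    HasDerivAt (fun t => f x / 2 / f t) (-f' / (2 * f x)) x := by
  convert! (hasDerivAt_const x (f x / 2)).div hf h0 using 1
  field_simp
  ring

lemma deriv_shear_horizontal {f : ℝ → ℝ} {f' x : ℝ} (c : ℝ) (hf : HasDerivAt f f' x)
    (h0 : f x ≠ 0) :
    deriv (fun t => c * (1 / 2 + f x / 2 / f t)) x = c * (-f' / (2 * f x)) :=
  (((hasDerivAt_gapRatio hf h0).const_add _).const_mul c).deriv

lemma deriv_shear_vertical {f g : ℝ → ℝ} {f' x : ℝ} (c : ℝ) (hf : HasDerivAt f f' x)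
    (h0 : f x ≠ 0) (hg : DifferentiableAt ℝ g x) :
    deriv (fun t => c * ((f x / 2 / f t) ^ 2 - 1 / 4) * (g t / 2)) x =
      c * (-f' / (2 * f x)) * (g x / 2) := by
  have h1 := ((((hasDerivAt_gapRatio hf h0).pow 2).sub_const (1 / 4)).const_mul c).mul
    (hg.hasDerivAt.div_const 2)
  refine (h1.congr_deriv ?_).deriv
  simp only [Pi.pow_apply]
  have : f x / 2 / f x = 1 / 2 := by field_simp
  rw [this]
  norm_num

lemma grad3_ubar1 {ε κ m x1 x2 : ℝ} (c : ℝ) (hκ : 0 < κ) (hε : 0 < ε)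
    (h : 0 < x1 ^ 2 + x2 ^ 2) :
    grad3 (ubar1 ε κ m c) x1 x2 (δf ε κ m x1 x2 / 2) =
      let δ := δf ε κ m x1 x2
      let D := d1δ κ m x1 x2
      let E := d1δ κ m x2 x1
      !![c * (-D / (2 * δ)), c * (-E / (2 * δ)), c / δ;
        0, 0, 0;
        c * (-D / (2 * δ)) * (D / 2), c * (-E / (2 * δ)) * (D / 2), c * D / (2 * δ)] := by
  have hδ : δf ε κ m x1 x2 ≠ 0 := (hε.trans_le (le_δf hκ)).ne'
  have hd1 := hasDerivAt_δf ε κ m x1 x2 h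
  have hd2 := hasDerivAt_δf ε κ m x2 x1 (by linarith)
  simp only [← δf_swap ε κ m x1] at hd2
  have h11 := deriv_shear_horizontal c hd1 hδ
  have h12 := deriv_shear_horizontal c hd2 hδ
  have h31 := deriv_shear_vertical c hd1 hδ (differentiableAt_d1δ_left κ m x1 x2 h)
  have h32 := deriv_shear_vertical c hd2 hδ (differentiableAt_d1δ_right κ m x1 x2 h)
  have hG : HasDerivAt (fun t => t / δf ε κ m x1 x2) (1 / δf ε κ m x1 x2)
      (δf ε κ m x1 x2 / 2) := (hasDerivAt_id _).div_const _
  have h13 := ((hG.const_add (1 / 2)).const_mul c).deriv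
  have h33 := ((((hG.pow 2).sub_const (1 / 4)).const_mul c).mul_const
    (d1δ κ m x1 x2 / 2)).deriv
  have hhalf : δf ε κ m x1 x2 / 2 / δf ε κ m x1 x2 = 1 / 2 := by field_simp
  simp only [Pi.pow_apply] at h33
  rw [hhalf] at h33
  ext i j
  fin_cases i <;> fin_cases j
  · exact h11
  · exact h12
  · exact h13.trans (mul_one_div _ _)
  · exact deriv_const _ _
  · exact deriv_const _ _
  · exact deriv_const _ _
  · exact h31
  · exact h32
  · exact h33.trans (by norm_num; ring)

lemma torque_eq_gapTorque {ε κ m x1 x2 : ℝ} (R μ c : ℝ) (hκ : 0 < κ) (hε : 0 < ε)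
    (h : 0 < x1 ^ 2 + x2 ^ 2) :
    crossProduct ![x1, x2, κ * Real.sqrt (x1 ^ 2 + x2 ^ 2) ^ m - R]
      ((sigma1 ε κ m μ c x1 x2 (δf ε κ m x1 x2 / 2)).mulVec
        ![κ * m * Real.sqrt (x1 ^ 2 + x2 ^ 2) ^ (m - 2) * x1,
          κ * m * Real.sqrt (x1 ^ 2 + x2 ^ 2) ^ (m - 2) * x2, -1]) =
      gapTorque ε κ R m μ c x1 x2 := by
  have hδ : δf ε κ m x1 x2 ≠ 0 := (hε.trans_le (le_δf hκ)).ne'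
  have hD : κ * m * Real.sqrt (x1 ^ 2 + x2 ^ 2) ^ (m - 2) * x1 = d1δ κ m x1 x2 / 2 := by
    simp only [d1δ]; ring
  have hE : κ * m * Real.sqrt (x1 ^ 2 + x2 ^ 2) ^ (m - 2) * x2 = d1δ κ m x2 x1 / 2 := by
    simp only [d1δ, add_comm (x2 ^ 2)]; ring
  rw [hD, hE]
  simp only [sigma1, symGrad, grad3_ubar1 c hκ hε h, pbar1, gapTorque, cross_apply]
  generalize δf ε κ m x1 x2 = δ at *
  generalize d1δ κ m x1 x2 = D at *
  generalize d1δ κ m x2 x1 = E at *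
  generalize κ * Real.sqrt (x1 ^ 2 + x2 ^ 2) ^ m - R = a at *
  ext i
  fin_cases i <;>
    simp [Matrix.mulVec, dotProduct, Fin.sum_univ_three, Matrix.one_apply] <;>
    field_simp <;> ring

lemma integrable_mul_exp_kernel {m κ ε : ℝ} (hm : 2 < m) (hκ : 0 < κ) (hε : 0 < ε) :
    Integrable (fun p : ℝ × ℝ => p.1 * Real.exp (-(p.2 * (ε + 2 * κ * p.1 ^ m))))
      ((volume.restrict (Set.Ioi 0)).prod (volume.restrict (Set.Ioi 0))) ∧
    ∀ t ∈ Set.Ioi (0 : ℝ), ∫ s in Set.Ioi 0, s * Real.exp (-(t * (ε + 2 * κ * s ^ m))) =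
      (2 * κ) ^ (-2 / m) * (1 / m) * Real.Gamma (2 / m) *
        (t ^ ((1 - 2 / m) - 1) * Real.exp (-(ε * t))) := by
  have hm0 : 0 < m := by linarith
  have hsplit : ∀ t s : ℝ, s * Real.exp (-(t * (ε + 2 * κ * s ^ m))) =
      (s ^ (1 : ℝ) * Real.exp (-(2 * κ * t) * s ^ m)) * Real.exp (-(ε * t)) := fun t s => by
    rw [Real.rpow_one, mul_assoc s, ← Real.exp_add]
    ring_nf
  have hval : ∀ t ∈ Set.Ioi (0 : ℝ),
      ∫ s in Set.Ioi 0, s * Real.exp (-(t * (ε + 2 * κ * s ^ m))) =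
      (2 * κ) ^ (-2 / m) * (1 / m) * Real.Gamma (2 / m) *
        (t ^ ((1 - 2 / m) - 1) * Real.exp (-(ε * t))) := by
    intro t ht
    have ht : 0 < t := ht
    simp_rw [hsplit t]
    rw [integral_mul_const, integral_rpow_mul_exp_neg_mul_rpow hm0 (by norm_num) (by positivity),
      Real.mul_rpow (by positivity) ht.le]
    norm_num
    rw [show -(2 / m) = -2 / m by ring]
    ring
  refine ⟨?_, hval⟩
  rw [integrable_prod_iff' (Measurable.aestronglyMeasurable (by fun_prop))]
  constructor
  · filter_upwards [ae_restrict_mem measurableSet_Ioi] with t ht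
    have ht : 0 < t := ht
    simp_rw [hsplit t]
    exact (integrableOn_rpow_mul_exp_neg_mul_rpow (by norm_num) hm0 (by positivity)).mul_const _
  · have hint : IntegrableOn (fun t : ℝ => (2 * κ) ^ (-2 / m) * (1 / m) * Real.Gamma (2 / m) *
        (t ^ ((1 - 2 / m) - 1) * Real.exp (-(ε * t)))) (Set.Ioi 0) := by
      refine Integrable.const_mul ?_ _
      have h2 : 2 / m < 1 := (div_lt_one hm0).2 hm
      have := integrableOn_rpow_mul_exp_neg_mul_rpow (p := 1) (s := (1 - 2 / m) - 1) (b := ε)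
        (by linarith) one_pos hε
      simpa [IntegrableOn] using this
    refine hint.congr ?_
    filter_upwards [ae_restrict_mem measurableSet_Ioi] with t ht
    rw [← hval t ht]
    refine setIntegral_congr_fun measurableSet_Ioi fun s hs => ?_
    have hs : 0 < s := hs
    exact (Real.norm_of_nonneg (by positivity)).symm

lemma integral_Ioi_div_gap {m κ ε : ℝ} (hm : 2 < m) (hκ : 0 < κ) (hε : 0 < ε) :
    IntegrableOn (fun s : ℝ => s / (ε + 2 * κ * s ^ m)) (Set.Ioi 0) ∧
    ∫ s in Set.Ioi 0, s / (ε + 2 * κ * s ^ m) = Γ12 κ m * ρ12 m ε := by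
  obtain ⟨hint, hval⟩ := integrable_mul_exp_kernel hm hκ hε
  have hm0 : 0 < m := by linarith
  have h2 : 2 / m < 1 := (div_lt_one hm0).2 hm
  have hpt : ∀ s ∈ Set.Ioi (0 : ℝ),
      ∫ t in Set.Ioi 0, s * Real.exp (-(t * (ε + 2 * κ * s ^ m))) = s / (ε + 2 * κ * s ^ m) := by
    intro s hs
    have hs : 0 < s := hs
    have hd : 0 < ε + 2 * κ * s ^ m := by positivity
    rw [integral_const_mul]
    have := integral_exp_mul_Ioi (a := -(ε + 2 * κ * s ^ m)) (by linarith) 0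
    simp only [mul_comm _ (ε + 2 * κ * s ^ m), ← neg_mul]
    rw [this]
    simp only [mul_zero, Real.exp_zero, neg_div_neg_eq]
    ring
  constructor
  · refine hint.integral_prod_left.congr ?_
    filter_upwards [ae_restrict_mem measurableSet_Ioi] with s hs using hpt s hs
  · rw [← setIntegral_congr_fun measurableSet_Ioi hpt, integral_integral_swap hint,
      setIntegral_congr_fun measurableSet_Ioi hval, integral_const_mul,
      Real.integral_rpow_mul_exp_neg_mul_Ioi (by linarith) hε, Γ12, ρ12, if_neg hm.ne',
      if_neg hm.ne', show -2 / m = -(2 / m) by ring, Real.rpow_neg (by positivity),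
      one_div ε, Real.inv_rpow hε.le, ← Real.rpow_neg hε.le, neg_sub]
    field_simp

lemma exists_abs_radialIntegral_sub_le_of_two_lt {m κ r : ℝ} (hm : 2 < m) (hκ : 0 < κ)
    (hr : 0 < r) :
    ∃ C, ∀ ε ∈ Set.Ioo (0 : ℝ) 1,
      |(∫ s in Set.Ioc 0 r, s / (ε + 2 * κ * s ^ m)) - Γ12 κ m * ρ12 m ε| ≤ C := by
  refine ⟨∫ s in Set.Ioi r, (1 / (2 * κ)) * s ^ (1 - m), fun ε hε => ?_⟩
  obtain ⟨hint, hval⟩ := integral_Ioi_div_gap hm hκ hε.1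
  have hint2 : IntegrableOn (fun s : ℝ => s / (ε + 2 * κ * s ^ m)) (Set.Ioi r) :=
    hint.mono_set (Set.Ioi_subset_Ioi hr.le)
  rw [← hval, ← Set.Ioc_union_Ioi_eq_Ioi hr.le,
    setIntegral_union (Set.Ioc_disjoint_Ioi le_rfl) measurableSet_Ioi
      (hint.mono_set Set.Ioc_subset_Ioi_self) hint2, sub_add_cancel_left, abs_neg]
  have hε0 := hε.1
  rw [abs_of_nonneg (setIntegral_nonneg measurableSet_Ioi fun s hs => by
    have hs : 0 < s := hr.trans hs
    positivity)]
  refine setIntegral_mono_on hint2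
    ((integrableOn_Ioi_rpow_of_lt (by linarith) hr).const_mul _) measurableSet_Ioi fun s hs => ?_
  have hs : 0 < s := hr.trans hs
  calc s / (ε + 2 * κ * s ^ m) ≤ s / (2 * κ * s ^ m) := by gcongr; linarith
    _ = 1 / (2 * κ) * s ^ (1 - m) := by
      rw [Real.rpow_sub hs, Real.rpow_one]; field_simp

lemma exists_abs_radialIntegral_sub_le_two {κ r : ℝ} (hκ : 0 < κ) (hr : 0 < r) :
    ∃ C, ∀ ε ∈ Set.Ioo (0 : ℝ) 1,
      |(∫ s in Set.Ioc 0 r, s / (ε + 2 * κ * s ^ (2 : ℝ))) - Γ12 κ 2 * ρ12 2 ε| ≤ C := by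
  refine ⟨1 / (4 * κ) * (|Real.log (2 * κ * r ^ 2)| + |Real.log (1 + 2 * κ * r ^ 2)|),
    fun ε hε => ?_⟩
  have hε0 := hε.1
  have hftc : ∫ s in (0 : ℝ)..r, s / (ε + 2 * κ * s ^ (2 : ℝ)) =
      1 / (4 * κ) * Real.log (ε + 2 * κ * r ^ 2) - 1 / (4 * κ) * Real.log (ε + 2 * κ * 0 ^ 2) := by
    simp only [Real.rpow_two]
    refine intervalIntegral.integral_eq_sub_of_hasDerivAt
      (f := fun s : ℝ => 1 / (4 * κ) * Real.log (ε + 2 * κ * s ^ 2)) (fun s _ => ?_) ?_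
    · have hd : 0 < ε + 2 * κ * s ^ 2 := by positivity
      convert! (((((hasDerivAt_pow 2 s).const_mul (2 * κ)).const_add ε).log hd.ne').const_mul
        (1 / (4 * κ))) using 1
      field_simp
      norm_num
      ring
    · refine Continuous.intervalIntegrable ?_ _ _
      exact continuous_id.div (by fun_prop) fun s => by positivity
  rw [← intervalIntegral.integral_of_le hr.le, hftc, Γ12, ρ12, if_pos rfl, if_pos rfl,
    abs_of_neg (Real.log_neg hε.1 hε.2)]
  rw [show 1 / (4 * κ) * Real.log (ε + 2 * κ * r ^ 2)
      - 1 / (4 * κ) * Real.log (ε + 2 * κ * 0 ^ 2) - 1 / (4 * κ) * -Real.log ε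
      = 1 / (4 * κ) * Real.log (ε + 2 * κ * r ^ 2) by simp,
    abs_mul, abs_of_pos (show 0 < 1 / (4 * κ) by positivity)]
  gcongr
  have h0 : 0 < 2 * κ * r ^ 2 := by positivity
  have h1 := Real.log_le_log h0 (show 2 * κ * r ^ 2 ≤ ε + 2 * κ * r ^ 2 by linarith)
  have h2 := Real.log_le_log (show 0 < ε + 2 * κ * r ^ 2 by linarith)
    (show ε + 2 * κ * r ^ 2 ≤ 1 + 2 * κ * r ^ 2 by linarith [hε.2])
  rw [abs_le]
  constructor
  · linarith [neg_abs_le (Real.log (2 * κ * r ^ 2)), abs_nonneg (Real.log (1 + 2 * κ * r ^ 2))]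
  · linarith [le_abs_self (Real.log (1 + 2 * κ * r ^ 2)), abs_nonneg (Real.log (2 * κ * r ^ 2))]

lemma exists_abs_radialIntegral_sub_le {m κ r : ℝ} (hm : 2 ≤ m) (hκ : 0 < κ) (hr : 0 < r) :
    ∃ C, ∀ ε ∈ Set.Ioo (0 : ℝ) 1,
      |(∫ s in Set.Ioc 0 r, s / (ε + 2 * κ * s ^ m)) - Γ12 κ m * ρ12 m ε| ≤ C := by
  rcases hm.eq_or_lt with rfl | hm
  · exact exists_abs_radialIntegral_sub_le_two hκ hr
  · exact exists_abs_radialIntegral_sub_le_of_two_lt hm hκ hr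

/-- The planar disk `|x'| < r`. -/
def gapDisk (r : ℝ) : Set (ℝ × ℝ) := {q | Real.sqrt (q.1 ^ 2 + q.2 ^ 2) < r}

lemma measurableSet_gapDisk (r : ℝ) : MeasurableSet (gapDisk r) :=
  measurableSet_lt (by fun_prop) measurable_const

lemma gapDisk_subset_Icc (r : ℝ) : gapDisk r ⊆ Set.Icc (-r, -r) (r, r) := by
  rintro ⟨x, y⟩ h
  have h : Real.sqrt (x ^ 2 + y ^ 2) < r := h
  have hx := abs_le.1 ((Real.abs_le_sqrt (show x ^ 2 ≤ x ^ 2 + y ^ 2 by nlinarith)).trans h.le)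
  have hy := abs_le.1 ((Real.abs_le_sqrt (show y ^ 2 ≤ x ^ 2 + y ^ 2 by nlinarith)).trans h.le)
  exact ⟨⟨hx.1, hy.1⟩, ⟨hx.2, hy.2⟩⟩

lemma volume_gapDisk_lt_top (r : ℝ) : volume (gapDisk r) < ⊤ :=
  (measure_mono (gapDisk_subset_Icc r)).trans_lt isCompact_Icc.measure_lt_top

lemma Continuous.integrableOn_gapDisk {f : ℝ × ℝ → ℝ} (hf : Continuous f) (r : ℝ) :
    IntegrableOn f (gapDisk r) :=
  (hf.continuousOn.integrableOn_compact isCompact_Icc).mono_set (gapDisk_subset_Icc r)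

lemma setIntegral_gapDisk_radial (g : ℝ → ℝ) (r : ℝ) :
    ∫ p in gapDisk r, g (Real.sqrt (p.1 ^ 2 + p.2 ^ 2)) =
      2 * Real.pi * ∫ s in Set.Ioc 0 r, s * g s := by
  have hnorm : ∀ p ∈ Set.Ioi (0 : ℝ) ×ˢ Set.Ioo (-Real.pi) Real.pi,
      Real.sqrt ((polarCoord.symm p).1 ^ 2 + (polarCoord.symm p).2 ^ 2) = p.1 := by
    rintro ⟨s, θ⟩ ⟨hs, -⟩
    have hs : 0 < s := hs
    simp only [polarCoord_symm_apply]
    rw [show (s * Real.cos θ) ^ 2 + (s * Real.sin θ) ^ 2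
      = s ^ 2 * (Real.sin θ ^ 2 + Real.cos θ ^ 2) by ring, Real.sin_sq_add_cos_sq, mul_one,
      Real.sqrt_sq hs.le]
  rw [← integral_indicator (measurableSet_gapDisk r), ← integral_comp_polarCoord_symm,
    polarCoord_target]
  have hcongr : ∀ p ∈ Set.Ioi (0 : ℝ) ×ˢ Set.Ioo (-Real.pi) Real.pi,
      p.1 • (gapDisk r).indicator (fun p => g (Real.sqrt (p.1 ^ 2 + p.2 ^ 2)))
        (polarCoord.symm p) = (Set.Iio r).indicator (fun s => s * g s) p.1 * 1 := by
    intro p hp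
    simp only [Set.indicator, gapDisk, Set.mem_ofPred_eq, hnorm p hp, Set.mem_Iio, smul_eq_mul]
    split_ifs <;> simp
  rw [setIntegral_congr_fun (measurableSet_Ioi.prod measurableSet_Ioo) hcongr,
    Measure.volume_eq_prod,
    setIntegral_prod_mul (fun s => (Set.Iio r).indicator (fun s => s * g s) s) (fun _ => 1),
    setIntegral_indicator measurableSet_Iio, Set.Ioi_inter_Iio, integral_Ioc_eq_integral_Ioo]
  simp [Real.pi_pos.le]
  ring

lemma setIntegral_gapDisk_eq_zero_of_odd {f : ℝ × ℝ → ℝ} (hf : ∀ x y, f (x, -y) = -f (x, y))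
    (r : ℝ) : ∫ p in gapDisk r, f p = 0 := by
  have hmp : MeasurePreserving
      (MeasurableEquiv.prodCongr (MeasurableEquiv.refl ℝ) (MeasurableEquiv.neg ℝ))
      (volume : Measure (ℝ × ℝ)) volume :=
    (MeasurePreserving.id volume).prod (Measure.measurePreserving_neg volume)
  have h := hmp.setIntegral_preimage_emb (MeasurableEquiv.measurableEmbedding _) f (gapDisk r)
  have hset : (MeasurableEquiv.prodCongr (MeasurableEquiv.refl ℝ) (MeasurableEquiv.neg ℝ)) ⁻¹'
      gapDisk r = gapDisk r := by
    ext ⟨x, y⟩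
    simp [gapDisk, MeasurableEquiv.prodCongr]
  have hfun : ∀ p : ℝ × ℝ,
      f ((MeasurableEquiv.prodCongr (MeasurableEquiv.refl ℝ) (MeasurableEquiv.neg ℝ)) p) = -f p :=
    fun p => hf p.1 p.2
  rw [hset] at h
  simp only [hfun, integral_neg] at h
  linarith

lemma continuous_gapTorque (ε κ R m μ c : ℝ) (hκ : 0 < κ) (hε : 0 < ε) (hm : 2 ≤ m) (i : Fin 3) :
    Continuous fun p : ℝ × ℝ => gapTorque ε κ R m μ c p.1 p.2 i := by
  have hpow : ∀ a : ℝ, 0 ≤ a → Continuous fun p : ℝ × ℝ => Real.sqrt (p.1 ^ 2 + p.2 ^ 2) ^ a :=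
    fun a ha => Continuous.rpow_const (by fun_prop) fun _ => Or.inr ha
  have hs := hpow m (by linarith)
  have hs2 := hpow (m - 2) (by linarith)
  have hδ : Continuous fun p : ℝ × ℝ => δf ε κ m p.1 p.2 := by
    unfold δf; fun_prop
  have hD : Continuous fun p : ℝ × ℝ => d1δ κ m p.1 p.2 := by
    unfold d1δ; fun_prop
  have hE : Continuous fun p : ℝ × ℝ => d1δ κ m p.2 p.1 := by
    have : ∀ p : ℝ × ℝ, d1δ κ m p.2 p.1 =
        2 * κ * m * Real.sqrt (p.1 ^ 2 + p.2 ^ 2) ^ (m - 2) * p.2 := fun p => by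
      rw [d1δ, add_comm (p.2 ^ 2)]
    simp only [this]; fun_prop
  have hq : Continuous fun p : ℝ × ℝ => μ * c / δf ε κ m p.1 p.2 :=
    continuous_const.div hδ fun p => (hε.trans_le (le_δf hκ)).ne'
  fin_cases i <;> simp only [gapTorque] <;> simp <;> fun_prop

lemma d1δ_neg_right (κ m x y : ℝ) : d1δ κ m x (-y) = d1δ κ m x y := by
  simp [d1δ]

lemma d1δ_neg_left (κ m x y : ℝ) : d1δ κ m (-x) y = -d1δ κ m x y := by
  simp [d1δ]

lemma δf_neg_right (ε κ m x y : ℝ) : δf ε κ m x (-y) = δf ε κ m x y := by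
  simp [δf]

lemma gapTorque_zero_neg (ε κ R m μ c x y : ℝ) :
    gapTorque ε κ R m μ c x (-y) 0 = -gapTorque ε κ R m μ c x y 0 := by
  simp [gapTorque, d1δ_neg_right, d1δ_neg_left, δf_neg_right]
  ring

lemma gapTorque_two_neg (ε κ R m μ c x y : ℝ) :
    gapTorque ε κ R m μ c x (-y) 2 = -gapTorque ε κ R m μ c x y 2 := by
  simp [gapTorque, d1δ_neg_right, d1δ_neg_left, δf_neg_right]
  ring

/-- The regular part of the torque density stays bounded as the gap closes. -/
lemma abs_gapTorque_one_sub_le {ε κ r R m μ c x y : ℝ} (hκ : 0 < κ) (hε : 0 < ε) (hR : 0 < R)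
    (hm : 2 ≤ m) (h0 : 0 < x ^ 2 + y ^ 2) (hr : Real.sqrt (x ^ 2 + y ^ 2) < r) :
    |gapTorque ε κ R m μ c x y 1 - R * (μ * c / δf ε κ m x y)| ≤
      |μ * c| * (1 / 2 + (κ * r ^ m + R + κ * m * r ^ m) * (2 * κ * m ^ 2 * r ^ (m - 2))) := by
  have hδ : 0 < δf ε κ m x y := hε.trans_le (le_δf hκ)
  set s := Real.sqrt (x ^ 2 + y ^ 2) with hs
  have hs0 : 0 < s := Real.sqrt_pos.2 h0
  have hss : s ^ 2 = x ^ 2 + y ^ 2 := Real.sq_sqrt h0.le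
  have hsm : s ^ m = s ^ (m - 2) * s ^ 2 := by
    rw [← Real.rpow_two, ← Real.rpow_add hs0]; congr 1; ring
  have hδs : δf ε κ m x y = ε + 2 * κ * s ^ m := rfl
  have hD : d1δ κ m x y = 2 * κ * m * s ^ (m - 2) * x := rfl
  have hE : d1δ κ m y x = 2 * κ * m * s ^ (m - 2) * y := by
    simp only [d1δ, hs, add_comm (y ^ 2)]
  have hT : gapTorque ε κ R m μ c x y 1 - R * (μ * c / δf ε κ m x y) = μ * c *
      (-(κ * s ^ m) / δf ε κ m x y
        + (R - κ * s ^ m) * ((d1δ κ m x y ^ 2 / 2 + d1δ κ m y x ^ 2 / 4) / δf ε κ m x y)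
        + x * d1δ κ m x y / 8 * ((d1δ κ m x y ^ 2 + d1δ κ m y x ^ 2) / δf ε κ m x y)) := by
    simp [gapTorque]
    ring
  rw [hT, abs_mul]
  have hr0 : 0 < r := hs0.trans hr
  have hpm : s ^ m ≤ r ^ m := Real.rpow_le_rpow hs0.le hr.le (by linarith)
  have hpm2 : s ^ (m - 2) ≤ r ^ (m - 2) := Real.rpow_le_rpow hs0.le hr.le (by linarith)
  have hq : 0 < s ^ m := by positivity
  have hq2 : 0 < s ^ (m - 2) := by positivity
  have hN : (d1δ κ m x y ^ 2 + d1δ κ m y x ^ 2) / δf ε κ m x y ≤ 2 * κ * m ^ 2 * r ^ (m - 2) := by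
    rw [div_le_iff₀ hδ]
    calc d1δ κ m x y ^ 2 + d1δ κ m y x ^ 2
        = 2 * κ * m ^ 2 * s ^ (m - 2) * (2 * κ * s ^ m) := by
          rw [hD, hE, hsm, hss]; ring
      _ ≤ 2 * κ * m ^ 2 * r ^ (m - 2) * δf ε κ m x y := by
          rw [hδs]; gcongr; linarith
  have hW : (d1δ κ m x y ^ 2 / 2 + d1δ κ m y x ^ 2 / 4) / δf ε κ m x y ≤
      2 * κ * m ^ 2 * r ^ (m - 2) := by
    refine le_trans ?_ hN
    gcongr
    · linarith [sq_nonneg (d1δ κ m x y)]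
    · linarith [sq_nonneg (d1δ κ m y x)]
  have h1 : |-(κ * s ^ m) / δf ε κ m x y| ≤ 1 / 2 := by
    rw [abs_div, abs_neg, abs_of_pos (by positivity), abs_of_pos hδ, div_le_iff₀ hδ, hδs]
    linarith
  have hh : κ * s ^ m ≤ κ * r ^ m := by gcongr
  have h2 : |R - κ * s ^ m| ≤ κ * r ^ m + R := by
    rw [abs_le]; constructor <;> nlinarith
  have h3 : |x * d1δ κ m x y / 8| ≤ κ * m * r ^ m := by
    have hx : x * d1δ κ m x y = 2 * κ * m * (s ^ (m - 2) * x ^ 2) := by rw [hD]; ring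
    have hle : s ^ (m - 2) * x ^ 2 ≤ r ^ m := by
      refine le_trans ?_ hpm
      rw [hsm]
      exact mul_le_mul_of_nonneg_left (by nlinarith) hq2.le
    have : κ * m * (s ^ (m - 2) * x ^ 2) ≤ κ * m * r ^ m := by gcongr
    rw [hx, abs_of_nonneg (by positivity)]
    have : 0 ≤ κ * m * (s ^ (m - 2) * x ^ 2) := by positivity
    linarith
  gcongr
  refine (abs_add_three _ _ _).trans ?_
  rw [abs_mul, abs_mul]
  rw [abs_of_nonneg (show 0 ≤ (d1δ κ m x y ^ 2 / 2 + d1δ κ m y x ^ 2 / 4) / δf ε κ m x y by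
      positivity), abs_of_nonneg (show
      0 ≤ (d1δ κ m x y ^ 2 + d1δ κ m y x ^ 2) / δf ε κ m x y by positivity)]
  have h4 := mul_le_mul h2 hW (by positivity) ((abs_nonneg _).trans h2)
  have h5 := mul_le_mul h3 hN (by positivity) ((abs_nonneg _).trans h3)
  linarith

lemma ae_sq_add_sq_pos : ∀ᵐ p : ℝ × ℝ, 0 < p.1 ^ 2 + p.2 ^ 2 := by
  filter_upwards [Measure.ae_ne volume (0 : ℝ × ℝ)] with p hp
  by_contra! h
  exact hp (Prod.ext (pow_eq_zero_iff two_ne_zero |>.1 (by linarith [sq_nonneg p.1, sq_nonneg p.2]))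
    (pow_eq_zero_iff two_ne_zero |>.1 (by linarith [sq_nonneg p.1, sq_nonneg p.2])))

lemma enorm3_of_zero_of_zero {v : Fin 3 → ℝ} (h0 : v 0 = 0) (h2 : v 2 = 0) :
    enorm3 v = |v 1| := by
  simp [enorm3, h0, h2, Real.sqrt_sq_eq_abs]

/-- Approximate shear torque from the gap:
`∫_{|x'|<r} (x₁,x₂,h−R) × [σ[ū⁽¹⁾,p̄⁽¹⁾](x',δ/2)·(∂₁h,∂₂h,−1)]dx'
= 2πμRcΓ₁₂⁽ᵐ⁾ρ₁₂⁽ᵐ⁾(ε)e₂ + O(1)`. -/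
theorem stmt16 (κ r R m μ c : ℝ) (hκ : 0 < κ) (hr : 0 < r) (hR : 0 < R)
    (hm : 2 ≤ m) (hμ : 0 < μ) :
    ∃ C > 0, ∀ ε ∈ Set.Ioo (0 : ℝ) 1,
      enorm3
        ((∫ p in {q : ℝ × ℝ | Real.sqrt (q.1 ^ 2 + q.2 ^ 2) < r},
          crossProduct
            ![p.1, p.2, κ * Real.sqrt (p.1 ^ 2 + p.2 ^ 2) ^ m - R]
            ((sigma1 ε κ m μ c p.1 p.2 (δf ε κ m p.1 p.2 / 2)).mulVec
              ![κ * m * Real.sqrt (p.1 ^ 2 + p.2 ^ 2) ^ (m - 2) * p.1,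
                κ * m * Real.sqrt (p.1 ^ 2 + p.2 ^ 2) ^ (m - 2) * p.2, -1]))
        - (2 * Real.pi * μ * R * c * Γ12 κ m * ρ12 m ε) • ![0, 1, 0]) ≤ C := by
  obtain ⟨C, hC⟩ := exists_abs_radialIntegral_sub_le hm hκ hr
  set K := |μ * c| * (1 / 2 + (κ * r ^ m + R + κ * m * r ^ m) * (2 * κ * m ^ 2 * r ^ (m - 2)))
    with hK
  have hK0 : 0 ≤ K := by positivity
  refine ⟨K * volume.real (gapDisk r) + |2 * Real.pi * μ * R * c| * |C| + 1, by positivity,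
    fun ε hε => ?_⟩
  have hε0 := hε.1
  have hcongr : ∀ᵐ p ∂(volume.restrict (gapDisk r)), crossProduct
      ![p.1, p.2, κ * Real.sqrt (p.1 ^ 2 + p.2 ^ 2) ^ m - R]
      ((sigma1 ε κ m μ c p.1 p.2 (δf ε κ m p.1 p.2 / 2)).mulVec
        ![κ * m * Real.sqrt (p.1 ^ 2 + p.2 ^ 2) ^ (m - 2) * p.1,
          κ * m * Real.sqrt (p.1 ^ 2 + p.2 ^ 2) ^ (m - 2) * p.2, -1]) =
      gapTorque ε κ R m μ c p.1 p.2 :=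
    (ae_restrict_of_ae ae_sq_add_sq_pos).mono fun p hp => torque_eq_gapTorque R μ c hκ hε0 hp
  change enorm3 ((∫ p in gapDisk r, _) - _) ≤ _
  rw [integral_congr_ae hcongr]
  have hint := fun i => (continuous_gapTorque ε κ R m μ c hκ hε0 hm i).integrableOn_gapDisk r
  have heval := eval_integral hint
  rw [enorm3_of_zero_of_zero]
  · have hmain : ∫ p in gapDisk r, R * (μ * c / δf ε κ m p.1 p.2) =
        2 * Real.pi * μ * R * c * ∫ s in Set.Ioc 0 r, s / (ε + 2 * κ * s ^ m) := by
      refine (setIntegral_gapDisk_radial (fun s => R * (μ * c / (ε + 2 * κ * s ^ m))) r).trans ?_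
      rw [← integral_const_mul, ← integral_const_mul]
      congr 1 with s
      ring
    have hintmain : IntegrableOn (fun p : ℝ × ℝ => R * (μ * c / δf ε κ m p.1 p.2)) (gapDisk r) := by
      refine Continuous.integrableOn_gapDisk ?_ r
      exact continuous_const.mul (continuous_const.div
        (continuous_const.add (continuous_const.mul (Continuous.rpow_const (by fun_prop)
          fun _ => Or.inr (by linarith)))) fun p => (hε0.trans_le (le_δf hκ)).ne')
    have hrem : ‖∫ p in gapDisk r,
        (gapTorque ε κ R m μ c p.1 p.2 1 - R * (μ * c / δf ε κ m p.1 p.2))‖ ≤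
        K * volume.real (gapDisk r) := by
      refine norm_setIntegral_le_of_norm_le_const_ae (volume_gapDisk_lt_top r) ?_
      filter_upwards [ae_restrict_of_ae ae_sq_add_sq_pos,
        ae_restrict_mem (measurableSet_gapDisk r)] with p hp hpr
      exact abs_gapTorque_one_sub_le hκ hε0 hR hm hp hpr
    rw [integral_sub (hint 1) hintmain, hmain, Real.norm_eq_abs] at hrem
    simp only [Pi.sub_apply, heval, Pi.smul_apply, smul_eq_mul, Matrix.cons_val_one,
      Matrix.cons_val_zero, mul_one]
    have hCε := (hC ε hε).trans (le_abs_self C)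
    have hrad : |2 * Real.pi * μ * R * c * (∫ s in Set.Ioc 0 r, s / (ε + 2 * κ * s ^ m)) -
        2 * Real.pi * μ * R * c * Γ12 κ m * ρ12 m ε| ≤ |2 * Real.pi * μ * R * c| * |C| := by
      rw [mul_assoc _ (Γ12 κ m), ← mul_sub, abs_mul]
      gcongr
    refine (abs_sub_le _ _ _).trans ((add_le_add hrem hrad).trans ?_)
    linarith
  · have h := setIntegral_gapDisk_eq_zero_of_odd
      (f := fun p => gapTorque ε κ R m μ c p.1 p.2 0) (gapTorque_zero_neg ε κ R m μ c) r
    simpa [heval] using h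
  · have h := setIntegral_gapDisk_eq_zero_of_odd
      (f := fun p => gapTorque ε κ R m μ c p.1 p.2 2) (gapTorque_two_neg ε κ R m μ c) r
    simpa [heval] using h
end
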